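/- arXiv:0801.2525 — 2 statements merged into one kernel-verified Lean document; each statement's English description precedes it below -/
import Mathlib

section
/- Let C₁ and C₂ be rigidity circuits on disjoint vertex sets, let e₁ = {a,b} ∈ C₁ and e₂ = {c,d} ∈ C₂. Then the 2-sum of C₁ and C₂ along e₁ and e₂ — the edge set (C₁ ∖ {e₁}) ∪ (C₂ ∖ {e₂}) after identifying a with c and b with d — is again a rigidity circuit. -/
/-- The two-element set of endpoints of an edge (an unordered pair of vertices). -/
def sym2Verts {V : Type*} [DecidableEq V] (e : Sym2 V) : Finset V :=
  Sym2.lift ⟨fun a b => {a, b}, fun a b => Finset.pair_comm a b⟩ e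

/-- The set `V(F)` of endpoints of the edges of a finite edge set `F`. -/
def edgeVerts {V : Type*} [DecidableEq V] (F : Finset (Sym2 V)) : Finset V :=
  F.sup sym2Verts

/-- An edge set `C` is a rigidity circuit if `|C| = 2|V(C)| - 2` and every proper
nonempty subset `F ⊊ C` satisfies Laman's condition `|F| ≤ 2|V(F)| - 3`. -/
def IsCircuit {V : Type*} [DecidableEq V] (C : Finset (Sym2 V)) : Prop :=
  C.card = 2 * (edgeVerts C).card - 2 ∧
  ∀ F ⊆ C, F.Nonempty → F ≠ C → F.card ≤ 2 * (edgeVerts F).card - 3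

theorem mem_edgeVerts' {V : Type*} [DecidableEq V] (F : Finset (Sym2 V)) (v : V) :
    v ∈ edgeVerts F ↔ ∃ e ∈ F, v ∈ e := by
  unfold edgeVerts
  rw [Finset.mem_sup]
  refine exists_congr fun e => and_congr_right fun _ => ?_
  induction e using Sym2.ind with
  | _ x y => simp [sym2Verts]

theorem edgeVerts_mono' {V : Type*} [DecidableEq V] {F G : Finset (Sym2 V)} (h : F ⊆ G) :
    edgeVerts F ⊆ edgeVerts G := by
  intro v hv
  rw [mem_edgeVerts'] at *
  obtain ⟨e, he, hv⟩ := hv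
  exact ⟨e, h he, hv⟩

theorem edgeVerts_union' {V : Type*} [DecidableEq V] (F G : Finset (Sym2 V)) :
    edgeVerts (F ∪ G) = edgeVerts F ∪ edgeVerts G := by
  unfold edgeVerts
  rw [Finset.sup_union]; rfl

theorem edgeVerts_image' {V : Type*} [DecidableEq V] (F : Finset (Sym2 V)) (f : V → V) :
    edgeVerts (F.image (Sym2.map f)) = (edgeVerts F).image f := by
  ext v
  simp only [mem_edgeVerts', Finset.mem_image]
  constructor
  · rintro ⟨_, ⟨e, he, rfl⟩, hv⟩
    obtain ⟨w, hw, rfl⟩ := Sym2.mem_map.1 hv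
    exact ⟨w, ⟨e, he, hw⟩, rfl⟩
  · rintro ⟨w, ⟨e, he, hw⟩, rfl⟩
    exact ⟨_, ⟨e, he, rfl⟩, Sym2.mem_map.2 ⟨w, hw, rfl⟩⟩

theorem map_injOn' {V : Type*} [DecidableEq V] (C : Finset (Sym2 V)) (f : V → V)
    (hf : Set.InjOn f (edgeVerts C)) : Set.InjOn (Sym2.map f) C := by
  intro e he e' he' h
  have h1 : ∀ v ∈ e, v ∈ edgeVerts C := fun v hv => (mem_edgeVerts' _ _).2 ⟨e, he, hv⟩
  have h2 : ∀ v ∈ e', v ∈ edgeVerts C := fun v hv => (mem_edgeVerts' _ _).2 ⟨e', he', hv⟩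
  clear he he'
  induction e using Sym2.ind with
  | _ x y =>
  induction e' using Sym2.ind with
  | _ z w =>
  simp only [Sym2.mem_iff, forall_eq_or_imp, forall_eq] at h1 h2
  simp only [Sym2.map_mk, Sym2.eq_iff] at h ⊢
  rcases h with ⟨h, h'⟩ | ⟨h, h'⟩
  · exact Or.inl ⟨hf h1.1 h2.1 h, hf h1.2 h2.2 h'⟩
  · exact Or.inr ⟨hf h1.1 h2.2 h, hf h1.2 h2.1 h'⟩

theorem IsCircuit.image' {V : Type*} [DecidableEq V] {C : Finset (Sym2 V)} (hC : IsCircuit C)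
    (f : V → V) (hf : Set.InjOn f (edgeVerts C)) : IsCircuit (C.image (Sym2.map f)) := by
  have hm := map_injOn' C f hf
  refine ⟨?_, ?_⟩
  · rw [edgeVerts_image', Finset.card_image_of_injOn hm, Finset.card_image_of_injOn hf]
    exact hC.1
  · intro F hF hne hFC
    obtain ⟨G, hG, rfl⟩ := Finset.subset_image_iff.1 hF
    have hG : G ⊆ C := by exact_mod_cast hG
    rw [edgeVerts_image', Finset.card_image_of_injOn (hm.mono (by exact_mod_cast hG)),
      Finset.card_image_of_injOn (hf.mono (by exact_mod_cast edgeVerts_mono' hG))]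
    refine hC.2 G hG (by simpa using hne) ?_
    rintro rfl
    exact hFC rfl

theorem IsCircuit.ne' {V : Type*} [DecidableEq V] {C : Finset (Sym2 V)} (hC : IsCircuit C)
    {a b : V} (h : s(a, b) ∈ C) : a ≠ b := by
  rintro rfl
  have hv : edgeVerts {s(a, a)} = {a} := by ext v; simp [mem_edgeVerts']
  by_cases hE : {s(a, a)} = C
  · have := hC.1
    rw [← hE, hv] at this
    simp at this
  · have := hC.2 {s(a, a)} (by simpa using h) (by simp) hE
    rw [hv] at this
    simp at this

/-- facts about subsets of a circuit missing an edge -/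
theorem IsCircuit.sub' {V : Type*} [DecidableEq V] {C : Finset (Sym2 V)} (hC : IsCircuit C)
    {a b : V} (h : s(a, b) ∈ C) {F : Finset (Sym2 V)} (hF : F ⊆ C.erase s(a, b))
    (hne : F.Nonempty) :
    F.card + 3 ≤ 2 * (edgeVerts F).card ∧
    (F ≠ C.erase s(a, b) → a ∈ edgeVerts F → b ∈ edgeVerts F →
      F.card + 4 ≤ 2 * (edgeVerts F).card) := by
  have heF : s(a, b) ∉ F := fun h' => by simpa using hF h'
  have hFC : F ⊆ C := hF.trans (Finset.erase_subset _ _)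
  have hpos := hne.card_pos
  constructor
  · have := hC.2 F hFC hne (by rintro rfl; exact heF h)
    omega
  · intro hp ha hb
    have hv : edgeVerts (insert s(a, b) F) = edgeVerts F := by
      ext v
      simp only [mem_edgeVerts', Finset.mem_insert, exists_eq_or_imp, Sym2.mem_iff]
      rw [← mem_edgeVerts']
      constructor
      · rintro ((rfl | rfl) | h) <;> assumption
      · exact Or.inr
    have := hC.2 (insert s(a, b) F) (Finset.insert_subset h hFC) (by simp)
      (by rintro rfl; exact hp (by rw [Finset.erase_insert heF]))
    rw [hv, Finset.card_insert_of_notMem heF] at this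
    omega

theorem IsCircuit.erase' {V : Type*} [DecidableEq V] {C : Finset (Sym2 V)} (hC : IsCircuit C)
    {a b : V} (h : s(a, b) ∈ C) :
    edgeVerts (C.erase s(a, b)) = edgeVerts C ∧
      (C.erase s(a, b)).card + 3 = 2 * (edgeVerts C).card ∧ (C.erase s(a, b)).Nonempty := by
  have hab := hC.ne' h
  have h2 : 2 ≤ (edgeVerts C).card := by
    rw [← Finset.card_pair hab]
    apply Finset.card_le_card
    intro v hv
    rw [mem_edgeVerts']
    exact ⟨_, h, by simpa using hv⟩
  have h1 := hC.1
  have hc := Finset.card_erase_add_one h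
  have hne : (C.erase s(a, b)).Nonempty := by
    rw [← Finset.card_pos]; omega
  have h3 := (hC.sub' h subset_rfl hne).1
  refine ⟨Finset.eq_of_subset_of_card_le (edgeVerts_mono' (Finset.erase_subset _ _)) ?_, ?_, hne⟩
  · omega
  · omega

theorem glue' {V : Type*} [DecidableEq V] {C D : Finset (Sym2 V)} (hC : IsCircuit C)
    (hD : IsCircuit D) {a b : V} (h : s(a, b) ∈ C) (h' : s(a, b) ∈ D)
    (hi : edgeVerts C ∩ edgeVerts D ⊆ {a, b}) :
    IsCircuit (C.erase s(a, b) ∪ D.erase s(a, b)) := by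
  have hab := hC.ne' h
  have hdj : Disjoint (C.erase s(a, b)) (D.erase s(a, b)) := by
    rw [Finset.disjoint_left]
    intro e he he'
    rw [Finset.mem_erase] at he he'
    have key : ∀ v ∈ e, v = a ∨ v = b := by
      intro v hv
      have := hi (Finset.mem_inter.2 ⟨(mem_edgeVerts' _ _).2 ⟨e, he.2, hv⟩,
        (mem_edgeVerts' _ _).2 ⟨e, he'.2, hv⟩⟩)
      simpa using this
    induction e using Sym2.ind with
    | _ x y =>
    have hxy := hC.ne' he.2
    have hx := key x (by simp)
    have hy := key y (by simp)
    apply he.1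
    rw [Sym2.eq_iff]
    grind
  have hC' := hC.erase' h
  have hD' := hD.erase' h'
  have memC : a ∈ edgeVerts C ∧ b ∈ edgeVerts C :=
    ⟨(mem_edgeVerts' _ _).2 ⟨_, h, by simp⟩, (mem_edgeVerts' _ _).2 ⟨_, h, by simp⟩⟩
  have memD : a ∈ edgeVerts D ∧ b ∈ edgeVerts D :=
    ⟨(mem_edgeVerts' _ _).2 ⟨_, h', by simp⟩, (mem_edgeVerts' _ _).2 ⟨_, h', by simp⟩⟩
  refine ⟨?_, ?_⟩
  · rw [edgeVerts_union', hC'.1, hD'.1, Finset.card_union_of_disjoint hdj]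
    have hi' : edgeVerts C ∩ edgeVerts D = {a, b} := by
      apply hi.antisymm
      intro v hv
      simp only [Finset.mem_insert, Finset.mem_singleton] at hv
      rcases hv with rfl | rfl
      · exact Finset.mem_inter.2 ⟨memC.1, memD.1⟩
      · exact Finset.mem_inter.2 ⟨memC.2, memD.2⟩
    have := Finset.card_union_add_card_inter (edgeVerts C) (edgeVerts D)
    rw [hi', Finset.card_pair hab] at this
    omega
  · intro F hF hne hFne
    obtain ⟨F₁, F₂, hF₁, hF₂, rfl⟩ : ∃ F₁ F₂, F₁ ⊆ C.erase s(a, b) ∧ F₂ ⊆ D.erase s(a, b) ∧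
        F = F₁ ∪ F₂ := by
      refine ⟨F ∩ C.erase s(a, b), F ∩ D.erase s(a, b), Finset.inter_subset_right,
        Finset.inter_subset_right, ?_⟩
      rw [← Finset.inter_union_distrib_left, Finset.inter_eq_left.2 hF]
    rcases F₁.eq_empty_or_nonempty with rfl | hn₁
    · rw [Finset.empty_union] at *
      have := (hD.sub' h' hF₂ hne).1
      omega
    rcases F₂.eq_empty_or_nonempty with rfl | hn₂
    · rw [Finset.union_empty] at *
      have := (hC.sub' h hF₁ hne).1
      omega
    have s1 := hC.sub' h hF₁ hn₁
    have s2 := hD.sub' h' hF₂ hn₂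
    rw [edgeVerts_union', Finset.card_union_of_disjoint (hdj.mono hF₁ hF₂)]
    have hcard := Finset.card_union_add_card_inter (edgeVerts F₁) (edgeVerts F₂)
    have hi2 : edgeVerts F₁ ∩ edgeVerts F₂ ⊆ {a, b} :=
      (Finset.inter_subset_inter (edgeVerts_mono' (hF₁.trans (Finset.erase_subset _ _)))
        (edgeVerts_mono' (hF₂.trans (Finset.erase_subset _ _)))).trans hi
    have hle := Finset.card_le_card hi2
    rw [Finset.card_pair hab] at hle
    by_cases h2 : (edgeVerts F₁ ∩ edgeVerts F₂).card ≤ 1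
    · omega
    · have heq := Finset.eq_of_subset_of_card_le hi2 (by rw [Finset.card_pair hab]; omega)
      have ha : a ∈ edgeVerts F₁ ∩ edgeVerts F₂ := by rw [heq]; simp
      have hb : b ∈ edgeVerts F₁ ∩ edgeVerts F₂ := by rw [heq]; simp
      rw [Finset.mem_inter] at ha hb
      by_cases e1 : F₁ = C.erase s(a, b)
      · have e2 : F₂ ≠ D.erase s(a, b) := by
          rintro rfl; exact hFne (by rw [e1])
        have := s2.2 e2 ha.2 hb.2
        omega
      · have := s1.2 e1 ha.1 hb.1
        omega

/-- **2-sum preserves rigidity circuits.**  If `C₁` and `C₂` are rigidity circuits on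
disjoint vertex sets, `e₁ = {a,b} ∈ C₁` and `e₂ = {c,d} ∈ C₂`, then the 2-sum of `C₁`
and `C₂` along `e₁` and `e₂` — the edge set `(C₁ ∖ {e₁}) ∪ (C₂ ∖ {e₂})` after
identifying `a` with `c` and `b` with `d` — is again a rigidity circuit. -/
theorem two_sum_circuit {V : Type*} [DecidableEq V] (C₁ C₂ : Finset (Sym2 V))
    (hC₁ : IsCircuit C₁) (hC₂ : IsCircuit C₂)
    (hdisj : Disjoint (edgeVerts C₁) (edgeVerts C₂))
    (a b c d : V) (he₁ : s(a, b) ∈ C₁) (he₂ : s(c, d) ∈ C₂) :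
    IsCircuit ((C₁.erase s(a, b)) ∪
      ((C₂.erase s(c, d)).image
        (Sym2.map fun v => if v = c then a else if v = d then b else v))) := by
  set f : V → V := fun v => if v = c then a else if v = d then b else v with hfdef
  have hab := hC₁.ne' he₁
  have hcd := hC₂.ne' he₂
  have ha : a ∉ edgeVerts C₂ :=
    Finset.disjoint_left.1 hdisj ((mem_edgeVerts' _ _).2 ⟨_, he₁, by simp⟩)
  have hb : b ∉ edgeVerts C₂ :=
    Finset.disjoint_left.1 hdisj ((mem_edgeVerts' _ _).2 ⟨_, he₁, by simp⟩)
  have hf : Set.InjOn f (edgeVerts C₂) := by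
    intro x hx y hy hxy
    rw [Finset.mem_coe] at hx hy
    simp only [hfdef] at hxy
    grind
  have hmap : Sym2.map f s(c, d) = s(a, b) := by
    simp [hfdef, hcd.symm]
  have himg : (C₂.erase s(c, d)).image (Sym2.map f) =
      (C₂.image (Sym2.map f)).erase s(a, b) := by
    have hm := map_injOn' C₂ f hf
    ext e
    simp only [Finset.mem_image, Finset.mem_erase]
    constructor
    · rintro ⟨x, ⟨hx, hxC⟩, rfl⟩
      refine ⟨fun h => hx (hm hxC he₂ (h.trans hmap.symm)), x, hxC, rfl⟩
    · rintro ⟨hne, x, hxC, rfl⟩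
      exact ⟨x, ⟨by rintro rfl; exact hne hmap, hxC⟩, rfl⟩
  rw [himg]
  refine glue' hC₁ (hC₂.image' f hf) he₁ (Finset.mem_image.2 ⟨_, he₂, hmap⟩) ?_
  intro v hv
  rw [Finset.mem_inter, edgeVerts_image', Finset.mem_image] at hv
  obtain ⟨hv1, w, hw, rfl⟩ := hv
  have hw1 : w ∉ edgeVerts C₁ := Finset.disjoint_right.1 hdisj hw
  simp only [hfdef] at hv1 ⊢
  split_ifs at hv1 ⊢ <;> simp_all
end

section
/- Let E be an edge set of a finite graph satisfying Laman's condition, let e = {u,w} ∈ E, let v be a new vertex not in V(E), and let x ∈ V(E) ∖ {u,w}. Then the edge set (E ∖ {e}) ∪ {{v,u}, {v,w}, {v,x}} obtained by the edge-split operation also satisfies Laman's condition. -/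
/-- Laman's condition: every nonempty subset `F'` of the edge set `F`
satisfies `|F'| ≤ 2|V(F')| - 3`. -/
def Laman {V : Type*} [DecidableEq V] (F : Finset (Sym2 V)) : Prop :=
  ∀ F' ⊆ F, F'.Nonempty → F'.card ≤ 2 * (edgeVerts F').card - 3

theorem mem_edgeVerts_iff {V : Type*} [DecidableEq V] (F : Finset (Sym2 V)) (a : V) :
    a ∈ edgeVerts F ↔ ∃ e ∈ F, a ∈ e := by
  unfold edgeVerts
  rw [Finset.mem_sup]
  refine exists_congr fun e => and_congr_right fun _ => ?_
  induction e with
  | _ p q => simp [sym2Verts]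

/-- **Edge-split preserves Laman's condition.**  If `E` satisfies Laman's condition,
`e = {u,w} ∈ E`, `v` is a new vertex not in `V(E)`, and `x ∈ V(E) ∖ {u,w}`, then the
edge set `(E ∖ {e}) ∪ {{v,u}, {v,w}, {v,x}}` also satisfies Laman's condition. -/
theorem edge_split_laman {V : Type*} [DecidableEq V] (E : Finset (Sym2 V))
    (hE : Laman E) (u w v x : V) (he : s(u, w) ∈ E) (hv : v ∉ edgeVerts E)
    (hx : x ∈ edgeVerts E) (hxu : x ≠ u) (hxw : x ≠ w) :
    Laman ((E.erase s(u, w)) ∪ {s(v, u), s(v, w), s(v, x)}) := by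
  intro F hF hne
  have hvu : u ∈ edgeVerts E := (mem_edgeVerts_iff _ _).2 ⟨_, he, by simp⟩
  have hvw : w ∈ edgeVerts E := (mem_edgeVerts_iff _ _).2 ⟨_, he, by simp⟩
  obtain ⟨A, hA⟩ : ∃ A, A = F ∩ E.erase s(u, w) := ⟨_, rfl⟩
  obtain ⟨N, hN⟩ : ∃ N, N = ({u, w, x} : Finset V).filter (fun y => s(v, y) ∈ F) := ⟨_, rfl⟩
  have hAF : A ⊆ F := hA ▸ Finset.inter_subset_left
  have hAE : A ⊆ E.erase s(u, w) := hA ▸ Finset.inter_subset_right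
  have hAE' : A ⊆ E := hAE.trans (Finset.erase_subset _ _)
  have hNF : ∀ y ∈ N, s(v, y) ∈ F := by
    intro y hy
    rw [hN] at hy
    exact (Finset.mem_filter.1 hy).2
  have hNE : ∀ y ∈ N, y ∈ edgeVerts E := by
    intro y hy
    rw [hN] at hy
    have := (Finset.mem_filter.1 hy).1
    simp only [Finset.mem_insert, Finset.mem_singleton] at this
    rcases this with rfl | rfl | rfl <;> assumption
  have hvN : v ∉ N := fun h => hv (hNE v h)
  have hmono : ∀ {S T : Finset (Sym2 V)}, S ⊆ T → edgeVerts S ⊆ edgeVerts T := by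
    intro S T h
    exact Finset.sup_mono h
  have hcard : F.card ≤ A.card + N.card := by
    have h1 : F ⊆ A ∪ N.image (fun y => s(v, y)) := by
      intro f hf
      have h2 := hF hf
      rw [Finset.mem_union] at h2 ⊢
      rcases h2 with h2 | h2
      · left
        rw [hA]
        exact Finset.mem_inter.2 ⟨hf, h2⟩
      · right
        simp only [Finset.mem_insert, Finset.mem_singleton] at h2
        rw [Finset.mem_image]
        rcases h2 with rfl | rfl | rfl
        · exact ⟨u, by rw [hN]; simp [hf], rfl⟩
        · exact ⟨w, by rw [hN]; simp [hf], rfl⟩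
        · exact ⟨x, by rw [hN]; simp [hf], rfl⟩
    calc F.card ≤ _ := Finset.card_le_card h1
      _ ≤ _ := Finset.card_union_le _ _
      _ ≤ _ := Nat.add_le_add_left Finset.card_image_le _
  have hvS : ∀ S ⊆ edgeVerts E, S ⊆ edgeVerts F → N.Nonempty →
      S.card + 1 ≤ (edgeVerts F).card := by
    intro S hS hSF ⟨y, hy⟩
    rw [← Finset.card_insert_of_notMem (fun h => hv (hS h))]
    refine Finset.card_le_card (Finset.insert_subset ?_ hSF)
    exact (mem_edgeVerts_iff _ _).2 ⟨_, hNF y hy, by simp⟩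
  have hNV : N ⊆ edgeVerts F := fun y hy =>
    (mem_edgeVerts_iff _ _).2 ⟨_, hNF y hy, by simp⟩
  have hFpos := hne.card_pos
  rcases N.eq_empty_or_nonempty with h0 | hNne
  · have hc : F.card ≤ A.card := by simpa [h0] using hcard
    have hAne : A.Nonempty := Finset.card_pos.1 (by omega)
    have h1 := hE A hAE' hAne
    have h2 := Finset.card_le_card (hmono hAF)
    omega
  have hNpos := hNne.card_pos
  by_cases huw : u ∈ N ∧ w ∈ N
  · have h3 : N.card ≤ 3 := by
      rw [hN]
      exact (Finset.card_filter_le _ _).trans Finset.card_le_three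
    have hs : insert s(u, w) A ⊆ E := Finset.insert_subset he hAE'
    have h1 := hE _ hs (Finset.insert_nonempty _ _)
    rw [Finset.card_insert_of_notMem
      (fun h => (Finset.notMem_erase _ _) (hAE h))] at h1
    have h2 := hvS (edgeVerts (insert s(u, w) A)) (hmono hs) (by
      intro a ha
      obtain ⟨f, hf, haf⟩ := (mem_edgeVerts_iff _ _).1 ha
      rcases Finset.mem_insert.1 hf with rfl | hf
      · rcases Sym2.mem_iff.1 haf with rfl | rfl
        · exact hNV huw.1
        · exact hNV huw.2
      · exact (mem_edgeVerts_iff _ _).2 ⟨f, hAF hf, haf⟩) hNne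
    omega
  · have h3 : N.card ≤ 2 := by
      have hsub : N ⊆ {u, w, x} := by rw [hN]; exact Finset.filter_subset _ _
      by_cases hu : u ∈ N
      · have hw : w ∉ N := fun h => huw ⟨hu, h⟩
        have : N ⊆ {u, x} := by
          intro y hy
          have := hsub hy
          simp only [Finset.mem_insert, Finset.mem_singleton] at this ⊢
          rcases this with h | rfl | h
          · exact Or.inl h
          · exact absurd hy hw
          · exact Or.inr h
        exact (Finset.card_le_card this).trans Finset.card_le_two
      · have : N ⊆ {w, x} := by
          intro y hy
          have := hsub hy
          simp only [Finset.mem_insert, Finset.mem_singleton] at this ⊢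
          rcases this with rfl | h
          · exact absurd hy hu
          · exact h
        exact (Finset.card_le_card this).trans Finset.card_le_two
    rcases A.eq_empty_or_nonempty with h0 | hAne
    · have hc : F.card ≤ N.card := by simpa [h0] using hcard
      have := hvS N hNE hNV hNne
      omega
    · have h1 := hE A hAE' hAne
      have h2 := hvS _ (hmono hAE') (hmono hAF) hNne
      have := hAne.card_pos
      omega
end
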